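/- Suppose the full-space LFU problem is feasible. Then the subspace LFU problem is feasible, all minimizers of the subspace LFU problem share a common Hessian Ĥ*, all minimizers of the full-space LFU problem share a common Hessian H*, and H* = Q Ĥ* Qᵀ + H̄ − Q Qᵀ H̄ Q Qᵀ. -/

import Mathlib

open Matrix

/-- Squared Frobenius norm of a real matrix. -/
noncomputable def frobSq {a b : ℕ} (A : Matrix (Fin a) (Fin b) ℝ) : ℝ :=
  ∑ i, ∑ j, (A i j) ^ 2

/-- Squared Euclidean norm of a real vector. -/
noncomputable def vecNormSq {a : ℕ} (v : Fin a → ℝ) : ℝ :=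
  ∑ i, (v i) ^ 2

/-- `v` lies in the orthogonal complement of the column space of `Q`. -/
def inColPerp {n d : ℕ} (Q : Matrix (Fin n) (Fin d) ℝ) (v : Fin n → ℝ) : Prop :=
  ∀ u : Fin d → ℝ, Q.mulVec u ⬝ᵥ v = 0

/-- Feasibility for the quadratic interpolation constraints: `p = (α, H)` with `H`
symmetric and `(dᵢ)ᵀ α + ½ (dᵢ)ᵀ H dᵢ = rhs i` for all `i`. -/
def QFeas {k m : ℕ} (dd : Fin m → Fin k → ℝ) (rhs : Fin m → ℝ)
    (p : (Fin k → ℝ) × Matrix (Fin k) (Fin k) ℝ) : Prop :=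
  p.2.IsSymm ∧ ∀ i, dd i ⬝ᵥ p.1 + (1 / 2) * (dd i ⬝ᵥ p.2.mulVec (dd i)) = rhs i

/-- Objective of the minimum norm (MN) problem. -/
noncomputable def MNObj {k : ℕ} (p : (Fin k → ℝ) × Matrix (Fin k) (Fin k) ℝ) : ℝ :=
  (1 / 2) * vecNormSq p.1 + (1 / 2) * frobSq p.2

/-- `p` is a minimizer of the MN problem. -/
def MNMin {k m : ℕ} (dd : Fin m → Fin k → ℝ) (rhs : Fin m → ℝ)
    (p : (Fin k → ℝ) × Matrix (Fin k) (Fin k) ℝ) : Prop :=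
  QFeas dd rhs p ∧ ∀ q, QFeas dd rhs q → MNObj p ≤ MNObj q

/-- Objective of the minimum Frobenius norm (MFN) problem. -/
noncomputable def MFNObj {k : ℕ} (p : (Fin k → ℝ) × Matrix (Fin k) (Fin k) ℝ) : ℝ :=
  (1 / 2) * frobSq p.2

/-- `p` is a minimizer of the MFN problem. -/
def MFNMin {k m : ℕ} (dd : Fin m → Fin k → ℝ) (rhs : Fin m → ℝ)
    (p : (Fin k → ℝ) × Matrix (Fin k) (Fin k) ℝ) : Prop :=
  QFeas dd rhs p ∧ ∀ q, QFeas dd rhs q → MFNObj p ≤ MFNObj q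

/-- Objective of the least Frobenius norm updating (LFU) problem. -/
noncomputable def LFUObj {k : ℕ} (Hbar : Matrix (Fin k) (Fin k) ℝ)
    (p : (Fin k → ℝ) × Matrix (Fin k) (Fin k) ℝ) : ℝ :=
  (1 / 2) * frobSq (p.2 - Hbar)

/-- `p` is a minimizer of the LFU problem with reference matrix `Hbar`. -/
def LFUMin {k m : ℕ} (dd : Fin m → Fin k → ℝ) (rhs : Fin m → ℝ)
    (Hbar : Matrix (Fin k) (Fin k) ℝ)
    (p : (Fin k → ℝ) × Matrix (Fin k) (Fin k) ℝ) : Prop :=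
  QFeas dd rhs p ∧ ∀ q, QFeas dd rhs q → LFUObj Hbar p ≤ LFUObj Hbar q

/-- `X` is a Moore–Penrose pseudoinverse of `A`. -/
def IsMPInv {a b : ℕ} (A : Matrix (Fin a) (Fin b) ℝ) (X : Matrix (Fin b) (Fin a) ℝ) : Prop :=
  A * X * A = A ∧ X * A * X = X ∧ (A * X)ᵀ = A * X ∧ (X * A)ᵀ = X * A

/-- The vector `δ_g(y⁰; W)` with `i`-th entry `g(y⁰ + wⁱ) − g(y⁰)`,
where `wⁱ` is the `i`-th column of `W`. -/
noncomputable def deltaVec {k p : ℕ} (g : (Fin k → ℝ) → ℝ) (y0 : Fin k → ℝ)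
    (W : Matrix (Fin k) (Fin p) ℝ) : Fin p → ℝ :=
  fun i => g (y0 + fun j => W j i) - g y0

theorem frobSq_eq_trace {a b : ℕ} (A : Matrix (Fin a) (Fin b) ℝ) :
    frobSq A = (Aᵀ * A).trace := by
  simp only [frobSq, trace, diag_apply, mul_apply, transpose_apply, ← pow_two]
  exact Finset.sum_comm

theorem frobSq_nonneg {a b : ℕ} (A : Matrix (Fin a) (Fin b) ℝ) : 0 ≤ frobSq A :=
  Finset.sum_nonneg fun _ _ => Finset.sum_nonneg fun _ _ => sq_nonneg _

theorem eq_zero_of_frobSq_nonpos {a b : ℕ} {A : Matrix (Fin a) (Fin b) ℝ} (h : frobSq A ≤ 0) :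
    A = 0 := by
  ext i j
  have hi := Finset.single_le_sum (f := fun i => ∑ j, (A i j) ^ 2)
    (fun _ _ => Finset.sum_nonneg fun _ _ => sq_nonneg _) (Finset.mem_univ i)
  have hj := Finset.single_le_sum (f := fun j => (A i j) ^ 2)
    (fun _ _ => sq_nonneg _) (Finset.mem_univ j)
  exact pow_eq_zero_iff two_ne_zero |>.mp
    (le_antisymm ((hj.trans hi).trans h) (sq_nonneg (A i j)))

/-- The parallelogram law for the Frobenius norm, written around a midpoint. -/
theorem frobSq_midpoint {a b : ℕ} (A B C : Matrix (Fin a) (Fin b) ℝ) :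
    frobSq ((1 / 2 : ℝ) • (A + B) - C) =
      (1 / 2) * frobSq (A - C) + (1 / 2) * frobSq (B - C) - (1 / 4) * frobSq (A - B) := by
  simp only [frobSq, Finset.mul_sum, ← Finset.sum_add_distrib, ← Finset.sum_sub_distrib]
  refine Finset.sum_congr rfl fun i _ => Finset.sum_congr rfl fun j _ => ?_
  simp only [Matrix.sub_apply, Matrix.add_apply, Matrix.smul_apply, smul_eq_mul]
  ring

theorem frobSq_conj {n d : ℕ} {Q : Matrix (Fin n) (Fin d) ℝ} (hQ : Qᵀ * Q = 1)
    (B : Matrix (Fin d) (Fin d) ℝ) : frobSq (Q * B * Qᵀ) = frobSq B := by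
  rw [frobSq_eq_trace, frobSq_eq_trace]
  calc ((Q * B * Qᵀ)ᵀ * (Q * B * Qᵀ)).trace
      = (Q * (Bᵀ * (Qᵀ * Q) * B * Qᵀ)).trace := by
        simp only [transpose_mul, transpose_transpose, Matrix.mul_assoc]
    _ = (Bᵀ * B * (Qᵀ * Q)).trace := by
        rw [trace_mul_comm, hQ, Matrix.mul_one, Matrix.mul_assoc, hQ, Matrix.mul_one]
    _ = (Bᵀ * B).trace := by rw [hQ, Matrix.mul_one]

theorem frobSq_compress_le {n d : ℕ} {Q : Matrix (Fin n) (Fin d) ℝ} (hQ : Qᵀ * Q = 1)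
    (A : Matrix (Fin n) (Fin n) ℝ) : frobSq (Qᵀ * A * Q) ≤ frobSq A := by
  set B := Qᵀ * A * Q with hB
  have cross : (Aᵀ * (Q * B * Qᵀ)).trace = frobSq B := by
    rw [frobSq_eq_trace, ← Matrix.mul_assoc, trace_mul_comm]
    simp only [hB, transpose_mul, transpose_transpose, Matrix.mul_assoc]
  have key : frobSq (A - Q * B * Qᵀ) = frobSq A - frobSq B := by
    have e := frobSq_conj hQ B
    have cross' : ((Q * B * Qᵀ)ᵀ * A).trace = frobSq B := by
      rw [← cross, ← trace_transpose, transpose_mul, transpose_transpose]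
    rw [frobSq_eq_trace] at e
    rw [frobSq_eq_trace, transpose_sub, Matrix.sub_mul, Matrix.mul_sub, Matrix.mul_sub,
      trace_sub, trace_sub, trace_sub, cross, cross', e, ← frobSq_eq_trace]
    ring
  linarith [frobSq_nonneg (A - Q * B * Qᵀ)]

theorem QFeas.midpoint {k m : ℕ} {dd : Fin m → Fin k → ℝ} {rhs : Fin m → ℝ}
    {p q : (Fin k → ℝ) × Matrix (Fin k) (Fin k) ℝ} (hp : QFeas dd rhs p) (hq : QFeas dd rhs q) :
    QFeas dd rhs ((1 / 2 : ℝ) • (p + q)) := by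
  refine ⟨(hp.1.add hq.1).smul _, fun i => ?_⟩
  have h1 := hp.2 i
  have h2 := hq.2 i
  simp only [Prod.smul_fst, Prod.fst_add, Prod.smul_snd, Prod.snd_add, dotProduct_smul,
    dotProduct_add, smul_mulVec, add_mulVec, smul_eq_mul]
  linarith

theorem LFUMin.hessian_eq {k m : ℕ} {dd : Fin m → Fin k → ℝ} {rhs : Fin m → ℝ}
    {Hbar : Matrix (Fin k) (Fin k) ℝ} {p q : (Fin k → ℝ) × Matrix (Fin k) (Fin k) ℝ}
    (hp : LFUMin dd rhs Hbar p) (hq : LFUMin dd rhs Hbar q) : p.2 = q.2 := by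
  have h1 := hp.2 _ (hp.1.midpoint hq.1)
  have h2 := hq.2 _ (hp.1.midpoint hq.1)
  simp only [LFUObj, Prod.smul_snd, Prod.snd_add, frobSq_midpoint] at h1 h2
  exact sub_eq_zero.mp (eq_zero_of_frobSq_nonpos (by linarith))

/-- Hessian parts of the solutions of the homogeneous interpolation system. -/
noncomputable def homogeneousHessians {k m : ℕ} (dd : Fin m → Fin k → ℝ) :
    Submodule ℝ (EuclideanSpace ℝ (Fin k × Fin k)) where
  carrier := {w | ∃ α, QFeas dd 0 (α, of fun i j => w (i, j))}
  zero_mem' := ⟨0, by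
    refine ⟨by ext; simp, fun i => ?_⟩
    have : (of fun i j => (0 : EuclideanSpace ℝ (Fin k × Fin k)) (i, j)) =
      (0 : Matrix (Fin k) (Fin k) ℝ) := rfl
    simp only [this, zero_mulVec, dotProduct_zero, mul_zero, add_zero, Pi.zero_apply]⟩
  add_mem' := by
    rintro v w ⟨α, hα⟩ ⟨β, hβ⟩
    refine ⟨α + β, hα.1.add hβ.1, fun i => ?_⟩
    have h1 := hα.2 i
    have h2 := hβ.2 i
    have : (of fun i j => (v + w) (i, j)) =
      ((of fun i j => v (i, j)) + (of fun i j => w (i, j)) : Matrix (Fin k) (Fin k) ℝ) := rfl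
    simp only [this, dotProduct_add, add_mulVec, Pi.zero_apply] at h1 h2 ⊢
    linarith
  smul_mem' := by
    rintro c v ⟨α, hα⟩
    refine ⟨c • α, hα.1.smul c, fun i => ?_⟩
    have h1 := hα.2 i
    have : (of fun i j => (c • v) (i, j)) =
      (c • (of fun i j => v (i, j)) : Matrix (Fin k) (Fin k) ℝ) := rfl
    simp only [this, dotProduct_smul, smul_mulVec, Pi.zero_apply, smul_eq_mul] at h1 ⊢
    linear_combination c * h1

theorem frobSq_eq_norm_sq {k : ℕ} (w : EuclideanSpace ℝ (Fin k × Fin k)) :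
    frobSq (of fun i j => w (i, j)) = ‖w‖ ^ 2 := by
  rw [EuclideanSpace.real_norm_sq_eq, Fintype.sum_prod_type]
  rfl

theorem exists_LFUMin {k m : ℕ} {dd : Fin m → Fin k → ℝ} {rhs : Fin m → ℝ}
    (Hbar : Matrix (Fin k) (Fin k) ℝ) (h : ∃ p, QFeas dd rhs p) :
    ∃ p, LFUMin dd rhs Hbar p := by
  obtain ⟨p, hp⟩ := h
  let K := homogeneousHessians dd
  let vec (A : Matrix (Fin k) (Fin k) ℝ) : EuclideanSpace ℝ (Fin k × Fin k) :=
    WithLp.toLp 2 fun ij => A ij.1 ij.2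
  let u := vec (Hbar - p.2)
  obtain ⟨β, hβ⟩ := K.starProjection_apply_mem u
  refine ⟨(p.1 + β, p.2 + of fun i j => K.starProjection u (i, j)),
    ⟨hp.1.add hβ.1, fun i => ?_⟩, fun q hq => ?_⟩
  · have h1 := hp.2 i
    have h2 := hβ.2 i
    simp only [dotProduct_add, add_mulVec, Pi.zero_apply] at h1 h2 ⊢
    linarith
  · have hw : vec (q.2 - p.2) ∈ K := by
      refine ⟨q.1 - p.1, hq.1.sub hp.1, fun i => ?_⟩
      have h1 := hp.2 i
      have h2 := hq.2 i
      have : (of fun i j => vec (q.2 - p.2) (i, j)) = q.2 - p.2 := rfl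
      simp only [this, dotProduct_sub, sub_mulVec, Pi.zero_apply]
      linarith
    have hmin : ‖u - K.starProjection u‖ ≤ ‖u - vec (q.2 - p.2)‖ := by
      rw [K.starProjection_minimal]
      exact ciInf_le ⟨0, by rintro _ ⟨_, rfl⟩; exact norm_nonneg _⟩ (⟨_, hw⟩ : K)
    have hsq := pow_le_pow_left₀ (norm_nonneg _) hmin 2
    rw [← frobSq_eq_norm_sq, ← frobSq_eq_norm_sq] at hsq
    have e1 : frobSq (of fun i j => (u - K.starProjection u) (i, j)) =
        frobSq (p.2 + (of fun i j => K.starProjection u (i, j)) - Hbar) :=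
      Finset.sum_congr rfl fun i _ => Finset.sum_congr rfl fun j _ => by
        simp [u, vec]; ring
    have e2 : frobSq (of fun i j => (u - vec (q.2 - p.2)) (i, j)) = frobSq (q.2 - Hbar) :=
      Finset.sum_congr rfl fun i _ => Finset.sum_congr rfl fun j _ => by
        simp [u, vec]; ring
    rw [e1, e2] at hsq
    simp only [LFUObj]
    linarith

theorem QFeas.compress {n d m : ℕ} {Q : Matrix (Fin n) (Fin d) ℝ} {dh : Fin m → Fin d → ℝ}
    {rhs : Fin m → ℝ} {p : (Fin n → ℝ) × Matrix (Fin n) (Fin n) ℝ}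
    (hp : QFeas (fun i => Q.mulVec (dh i)) rhs p) :
    QFeas dh rhs (Qᵀ.mulVec p.1, Qᵀ * p.2 * Q) := by
  refine ⟨?_, fun i => ?_⟩
  · simp only [IsSymm, transpose_mul, transpose_transpose, hp.1.eq, Matrix.mul_assoc]
  · rw [← hp.2 i]
    simp only [← mulVec_mulVec, dotProduct_mulVec _ Qᵀ, vecMul_transpose]

theorem QFeas.lift {n d m : ℕ} {Q : Matrix (Fin n) (Fin d) ℝ} (hQ : Qᵀ * Q = 1)
    {dh : Fin m → Fin d → ℝ} {rhs : Fin m → ℝ} {αh : Fin d → ℝ} {Hh : Matrix (Fin d) (Fin d) ℝ}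
    (hp : QFeas dh rhs (αh, Hh)) {H : Matrix (Fin n) (Fin n) ℝ} (hH : H.IsSymm)
    (hHQ : Qᵀ * H * Q = Hh) :
    QFeas (fun i => Q.mulVec (dh i)) rhs (Q.mulVec αh, H) := by
  refine ⟨hH, fun i => ?_⟩
  rw [← hp.2 i, ← hHQ]
  simp only [← mulVec_mulVec, dotProduct_mulVec _ Qᵀ, vecMul_transpose]
  rw [dotProduct_mulVec, ← vecMul_transpose, vecMul_vecMul, hQ, vecMul_one]

theorem LFUMin.lift {n d m : ℕ} {Q : Matrix (Fin n) (Fin d) ℝ} (hQ : Qᵀ * Q = 1)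
    {dh : Fin m → Fin d → ℝ} {rhs : Fin m → ℝ} {Hbar : Matrix (Fin n) (Fin n) ℝ}
    (hHbar : Hbar.IsSymm) {αh : Fin d → ℝ} {Hh : Matrix (Fin d) (Fin d) ℝ}
    (hmin : LFUMin dh rhs (Qᵀ * Hbar * Q) (αh, Hh)) :
    LFUMin (fun i => Q.mulVec (dh i)) rhs Hbar
      (Q.mulVec αh, Q * (Hh - Qᵀ * Hbar * Q) * Qᵀ + Hbar) := by
  refine ⟨hmin.1.lift hQ ?_ ?_, fun q hq => ?_⟩
  · have hHh : Hhᵀ = Hh := hmin.1.1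
    simp only [IsSymm, transpose_add, transpose_sub, transpose_mul, transpose_transpose,
      hHbar.eq, hHh, Matrix.mul_assoc]
  · have hc : Qᵀ * (Q * (Hh - Qᵀ * Hbar * Q) * Qᵀ) * Q =
        (Qᵀ * Q) * (Hh - Qᵀ * Hbar * Q) * (Qᵀ * Q) := by
      simp only [Matrix.mul_assoc]
    rw [Matrix.mul_add, Matrix.add_mul, hc, hQ, Matrix.one_mul, Matrix.mul_one, sub_add_cancel]
  · have h1 := hmin.2 _ hq.compress
    have h2 := frobSq_compress_le hQ (q.2 - Hbar)
    rw [Matrix.mul_sub, Matrix.sub_mul] at h2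
    simp only [LFUObj, add_sub_cancel_right, frobSq_conj hQ] at h1 ⊢
    linarith

/-- If the full-space LFU problem is feasible, then the subspace LFU
problem is feasible, all minimizers of the subspace problem share a common Hessian
`Ĥ*`, all minimizers of the full-space problem share a common Hessian `H*`, and
`H* = Q Ĥ* Qᵀ + H̄ − Q Qᵀ H̄ Q Qᵀ`. -/
theorem stmt_8 {n d m : ℕ} (hn : 0 < n) (hd : 0 < d) (hm : 0 < m) (hdn : d < n)
    (Q : Matrix (Fin n) (Fin d) ℝ) (hQ : Qᵀ * Q = 1)
    (f : (Fin n → ℝ) → ℝ) (x0 : Fin n → ℝ) (dh : Fin m → Fin d → ℝ)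
    (fh : (Fin d → ℝ) → ℝ) (hfh : ∀ xh, fh xh = f (x0 + Q.mulVec xh))
    (Hbar : Matrix (Fin n) (Fin n) ℝ) (hHbar : Hbar.IsSymm)
    (hfeas : ∃ p, QFeas (fun i => Q.mulVec (dh i))
      (fun i => f (x0 + Q.mulVec (dh i)) - f x0) p) :
    (∃ p, QFeas dh (fun i => fh (dh i) - fh 0) p) ∧
    ∃ (Hhs : Matrix (Fin d) (Fin d) ℝ) (Hs : Matrix (Fin n) (Fin n) ℝ),
      (∃ αh, LFUMin dh (fun i => fh (dh i) - fh 0) (Qᵀ * Hbar * Q) (αh, Hhs)) ∧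
      (∀ p, LFUMin dh (fun i => fh (dh i) - fh 0) (Qᵀ * Hbar * Q) p → p.2 = Hhs) ∧
      (∃ α, LFUMin (fun i => Q.mulVec (dh i))
        (fun i => f (x0 + Q.mulVec (dh i)) - f x0) Hbar (α, Hs)) ∧
      (∀ p, LFUMin (fun i => Q.mulVec (dh i))
        (fun i => f (x0 + Q.mulVec (dh i)) - f x0) Hbar p → p.2 = Hs) ∧
      Hs = Q * Hhs * Qᵀ + Hbar - Q * Qᵀ * Hbar * Q * Qᵀ := by
  have hrhs : (fun i => fh (dh i) - fh 0) = fun i => f (x0 + Q.mulVec (dh i)) - f x0 := by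
    funext i
    simp [hfh]
  rw [hrhs]
  obtain ⟨p, hp⟩ := hfeas
  obtain ⟨⟨αh, Hh⟩, hmin⟩ := exists_LFUMin (Qᵀ * Hbar * Q) ⟨_, hp.compress⟩
  have hfull := hmin.lift hQ hHbar
  refine ⟨⟨_, hp.compress⟩, Hh, Q * (Hh - Qᵀ * Hbar * Q) * Qᵀ + Hbar, ⟨αh, hmin⟩,
    fun q hq => hq.hessian_eq hmin, ⟨_, hfull⟩, fun q hq => hq.hessian_eq hfull, ?_⟩
  simp only [Matrix.mul_sub, Matrix.sub_mul, Matrix.mul_assoc]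
  abel
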